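/- Let n ≥ 3 and let A be an n×n real symmetric positive definite matrix with n distinct eigenvalues. Equip S*E_A = {(x, ξ) ∈ ℝⁿ × ℝⁿ : ⟨A⁻¹x, x⟩ = 1, ⟨A⁻¹x, ξ⟩ = 0, ‖ξ‖ = 1} with the subspace topology from ℝⁿ × ℝⁿ. Then there exists a subset U ⊆ S*E_A, open and dense in S*E_A, such that for every (x, ξ) ∈ U the spectrum of L(x, ξ) consists of exactly n−1 distinct real numbers; that is, the n−2 nonzero eigenvalues of L(x, ξ) are pairwise distinct (each simple), in addition to the eigenvalue 0 of multiplicity two. -/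

import Mathlib

open Matrix

/-- The orthogonal projection onto the hyperplane orthogonal to a unit vector `ξ`:
`P_ξ = I - ξ ξᵀ`. -/
noncomputable def projPerp {n : ℕ} (ξ : Fin n → ℝ) : Matrix (Fin n) (Fin n) ℝ :=
  1 - vecMulVec ξ ξ

/-- Moser's Lax matrix `L(x, ξ) = P_ξ (A - x xᵀ) P_ξ`. -/
noncomputable def moserLax {n : ℕ} (A : Matrix (Fin n) (Fin n) ℝ) (x ξ : Fin n → ℝ) :
    Matrix (Fin n) (Fin n) ℝ :=
  projPerp ξ * (A - vecMulVec x x) * projPerp ξ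

/-- The unit cosphere bundle `S*E_A` of the ellipsoid, as a subtype of `ℝⁿ × ℝⁿ`. -/
def CosphereBundle {n : ℕ} (A : Matrix (Fin n) (Fin n) ℝ) : Type :=
  {p : (Fin n → ℝ) × (Fin n → ℝ) //
    A⁻¹.mulVec p.1 ⬝ᵥ p.1 = 1 ∧ A⁻¹.mulVec p.1 ⬝ᵥ p.2 = 0 ∧ p.2 ⬝ᵥ p.2 = 1}

instance {n : ℕ} (A : Matrix (Fin n) (Fin n) ℝ) : TopologicalSpace (CosphereBundle A) :=
  instTopologicalSpaceSubtype

section Hankel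

variable {ι : Type*} [Fintype ι] [DecidableEq ι]

/-- The Hankel determinant of the power traces `tr (M ^ (i + j))`, `i, j < m`. -/
def hankelDet {R : Type*} [CommRing R] (m : ℕ) (M : Matrix ι ι R) : R :=
  (Matrix.of fun i j : Fin m => (M ^ ((i : ℕ) + j)).trace).det

theorem map_hankelDet {R S : Type*} [CommRing R] [CommRing S] (f : R →+* S) (m : ℕ)
    (M : Matrix ι ι R) : f (hankelDet m M) = hankelDet m (M.map f) := by
  simp only [hankelDet, RingHom.map_det]
  congr 1
  ext i j
  simp only [RingHom.mapMatrix_apply, Matrix.map_apply, Matrix.of_apply, AddMonoidHom.map_trace]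
  rw [← RingHom.mapMatrix_apply, map_pow, RingHom.mapMatrix_apply]

theorem hankelDet_smul {R : Type*} [CommRing R] (m : ℕ) (c : R) (M : Matrix ι ι R) :
    hankelDet m (c • M) = (∏ i : Fin m, c ^ (i : ℕ)) ^ 2 * hankelDet m M := by
  have h : (Matrix.of fun i j : Fin m => ((c • M) ^ ((i : ℕ) + j)).trace) =
      diagonal (fun i : Fin m => c ^ (i : ℕ)) *
        (Matrix.of fun i j : Fin m => (M ^ ((i : ℕ) + j)).trace) *
        diagonal (fun i : Fin m => c ^ (i : ℕ)) := by
    ext i j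
    simp only [mul_diagonal, diagonal_mul, of_apply, smul_pow, trace_smul, smul_eq_mul]
    rw [pow_add]
    ring
  rw [hankelDet, h, det_mul, det_mul, det_diagonal, hankelDet]
  ring

theorem continuous_hankelDet (m : ℕ) :
    Continuous (hankelDet m : Matrix ι ι ℝ → ℝ) := by
  unfold hankelDet
  refine Continuous.matrix_det (continuous_matrix fun i j => ?_)
  simp only [of_apply]
  fun_prop

theorem Matrix.IsHermitian.trace_pow {M : Matrix ι ι ℝ} (hM : M.IsHermitian) (k : ℕ) :
    (M ^ k).trace = ∑ i, hM.eigenvalues i ^ k := by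
  conv_lhs => rw [hM.spectral_theorem, ← map_pow, Unitary.conjStarAlgAut_apply, trace_mul_cycle]
  simp [diagonal_pow, trace_diagonal]

/-- The Hankel determinant of size `m` detects whether there are at least `m` distinct
eigenvalues. -/
theorem hankelDet_ne_zero_iff {M : Matrix ι ι ℝ} (hM : M.IsHermitian) (m : ℕ) :
    hankelDet m M ≠ 0 ↔ m ≤ (Finset.univ.image hM.eigenvalues).card := by
  let V : Matrix ι (Fin m) ℝ := Matrix.of fun i k => hM.eigenvalues i ^ (k : ℕ)
  have hV : hankelDet m M = (Vᵀ * V).det := by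
    unfold hankelDet
    congr 1
    ext i j
    simp only [V, of_apply, hM.trace_pow, mul_apply, transpose_apply, ← pow_add]
  have hker : ∀ c : Fin m → ℝ, (Vᵀ * V) *ᵥ c = 0 ↔ V *ᵥ c = 0 := fun c => by
    simpa only [LinearMap.mem_ker, mulVecLin_apply] using
      SetLike.ext_iff.1 (ker_mulVecLin_transpose_mul_self V) c
  have hVc : ∀ (c : Fin m → ℝ) (i : ι),
      (V *ᵥ c) i = (∑ k : Fin m, Polynomial.C (c k) * Polynomial.X ^ (k : ℕ)).eval
        (hM.eigenvalues i) := fun c i => by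
    simp only [V, mulVec, dotProduct, of_apply, Polynomial.eval_finsetSum, Polynomial.eval_mul,
      Polynomial.eval_C, Polynomial.eval_pow, Polynomial.eval_X]
    exact Finset.sum_congr rfl fun k _ => mul_comm _ _
  rw [hV, ← not_lt, not_iff_not, ← exists_mulVec_eq_zero_iff]
  constructor
  · rintro ⟨c, hc0, hc⟩
    rw [hker] at hc
    set q : Polynomial ℝ := ∑ k : Fin m, Polynomial.C (c k) * Polynomial.X ^ (k : ℕ) with hq
    have hcoeff : ∀ k : Fin m, q.coeff k = c k := fun k => by
      simp [hq, Polynomial.coeff_X_pow, Fin.val_inj]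
    have hq0 : q ≠ 0 := fun h => hc0 (by ext k; rw [← hcoeff, h]; simp)
    have hdeg : q.degree < m := by
      refine lt_of_le_of_lt (Polynomial.degree_sum_le _ _) ?_
      refine (Finset.sup_lt_iff (WithBot.bot_lt_coe m)).2 fun k _ => ?_
      exact (Polynomial.degree_C_mul_X_pow_le _ _).trans_lt (Nat.cast_lt.2 k.2)
    have hle : (Finset.univ.image hM.eigenvalues).card ≤ q.natDegree := by
      refine Polynomial.card_le_degree_of_subset_roots fun a ha => ?_
      obtain ⟨i, -, rfl⟩ := Finset.mem_image.1 ha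
      rw [Polynomial.mem_roots hq0, Polynomial.IsRoot, ← hVc, hc]
      rfl
    exact hle.trans_lt ((Polynomial.natDegree_lt_iff_degree_lt hq0).2 hdeg)
  · intro hlt
    set q : Polynomial ℝ := ∏ a ∈ Finset.univ.image hM.eigenvalues,
      (Polynomial.X - Polynomial.C a) with hq
    have hmonic : q.Monic := Polynomial.monic_prod_X_sub_C _ _
    have hnat : q.natDegree < m := by
      rw [hq, Polynomial.natDegree_finsetProd_X_sub_C_eq_card]
      exact hlt
    have hsum : ∑ k : Fin m, Polynomial.C (q.coeff k) * Polynomial.X ^ (k : ℕ) = q := by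
      rw [Fin.sum_univ_eq_sum_range (fun k => Polynomial.C (q.coeff k) * Polynomial.X ^ k)]
      exact (Polynomial.as_sum_range_C_mul_X_pow' q hnat).symm
    refine ⟨fun k => q.coeff k, fun h => ?_, ?_⟩
    · have := congrFun h ⟨q.natDegree, hnat⟩
      simp [hmonic.coeff_natDegree] at this
    · rw [hker]
      ext i
      rw [hVc, hsum, hq, Polynomial.eval_prod]
      exact Finset.prod_eq_zero (Finset.mem_image_of_mem _ (Finset.mem_univ i)) (by simp)

end Hankel

section Eigenvectors

variable {ι : Type*} [Fintype ι]

theorem Matrix.IsHermitian.dotProduct_mulVec_comm {M : Matrix ι ι ℝ} (hM : M.IsHermitian)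
    (v w : ι → ℝ) : v ⬝ᵥ (M *ᵥ w) = (M *ᵥ v) ⬝ᵥ w := by
  have hT : Mᵀ = M := by simpa [IsHermitian] using hM
  rw [dotProduct_mulVec, ← mulVec_transpose, hT]

/-- An eigenvector of a real symmetric matrix is orthogonal to the eigenvectors for other
eigenvalues. -/
theorem Matrix.IsHermitian.dotProduct_eq_zero {M : Matrix ι ι ℝ} (hM : M.IsHermitian)
    {v w : ι → ℝ} {a c : ℝ} (hv : M *ᵥ v = a • v) (hw : M *ᵥ w = c • w) (hac : a ≠ c) :
    v ⬝ᵥ w = 0 := by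
  have h := hM.dotProduct_mulVec_comm v w
  rw [hv, hw, dotProduct_smul, smul_dotProduct, smul_eq_mul, smul_eq_mul] at h
  have h' : (a - c) * (v ⬝ᵥ w) = 0 := by linarith
  exact (mul_eq_zero.1 h').resolve_left (sub_ne_zero.2 hac)

variable [DecidableEq ι]

/-- A real symmetric matrix has an orthonormal basis of eigenvectors, in terms of the dot
product. -/
theorem Matrix.IsHermitian.exists_orthonormal_eigenvectors {M : Matrix ι ι ℝ}
    (hM : M.IsHermitian) : ∃ b : ι → ι → ℝ,
      (∀ i j, b i ⬝ᵥ b j = if i = j then 1 else 0) ∧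
      (∀ i, M *ᵥ b i = hM.eigenvalues i • b i) ∧
      ∀ p : ι → ℝ, p = ∑ i, (b i ⬝ᵥ p) • b i := by
  refine ⟨fun i => (hM.eigenvectorBasis i).ofLp, fun i j => ?_,
    fun i => hM.mulVec_eigenvectorBasis i, fun p => ?_⟩
  · have := orthonormal_iff_ite.1 hM.eigenvectorBasis.orthonormal j i
    simpa [EuclideanSpace.inner_eq_star_dotProduct, eq_comm] using this
  · have := congrArg WithLp.ofLp (hM.eigenvectorBasis.sum_repr' (WithLp.toLp 2 p))
    simpa [EuclideanSpace.inner_eq_star_dotProduct, WithLp.ofLp_sum, dotProduct_comm]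
      using this.symm

theorem Matrix.IsHermitian.exists_eigenvalues_eq {M : Matrix ι ι ℝ} (hM : M.IsHermitian)
    {v : ι → ℝ} {a : ℝ} (hv : M *ᵥ v = a • v) (hv0 : v ≠ 0) : ∃ i, hM.eigenvalues i = a := by
  obtain ⟨b, -, hb, hsum⟩ := hM.exists_orthonormal_eigenvectors
  by_contra! h
  refine hv0 ?_
  rw [hsum v]
  exact Finset.sum_eq_zero fun i _ => by rw [hM.dotProduct_eq_zero (hb i) hv (h i), zero_smul]

/-- If the eigenvalues are distinct, then any two eigenvectors for the same eigenvalue are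
proportional. -/
theorem Matrix.IsHermitian.exists_eq_smul {M : Matrix ι ι ℝ} (hM : M.IsHermitian)
    (hinj : Function.Injective hM.eigenvalues) {p q : ι → ℝ} {a : ℝ}
    (hp : M *ᵥ p = a • p) (hq : M *ᵥ q = a • q) (hq0 : q ≠ 0) : ∃ r : ℝ, p = r • q := by
  obtain ⟨b, -, hb, hsum⟩ := hM.exists_orthonormal_eigenvectors
  obtain ⟨i, hi⟩ := hM.exists_eigenvalues_eq hq hq0
  have key : ∀ v : ι → ℝ, M *ᵥ v = a • v → v = (b i ⬝ᵥ v) • b i := fun v hv => by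
    conv_lhs => rw [hsum v]
    refine Finset.sum_eq_single i (fun j _ hj => ?_) (by simp)
    rw [hM.dotProduct_eq_zero (hb j) hv (fun h => hj (hinj (h.trans hi.symm))), zero_smul]
  have hne : b i ⬝ᵥ q ≠ 0 := fun h => hq0 (by rw [key q hq, h, zero_smul])
  refine ⟨(b i ⬝ᵥ p) / (b i ⬝ᵥ q), ?_⟩
  calc p = (b i ⬝ᵥ p) • b i := key p hp
    _ = ((b i ⬝ᵥ p) / (b i ⬝ᵥ q)) • ((b i ⬝ᵥ q) • b i) := by
      rw [smul_smul, div_mul_cancel₀ _ hne]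
    _ = ((b i ⬝ᵥ p) / (b i ⬝ᵥ q)) • q := by rw [← key q hq]

end Eigenvectors

section MoserLax

variable {n : ℕ}

/-- The matrix `L(x, ξ)` multiplied by `‖ξ‖⁴`, which is polynomial in `ξ`. -/
def homogeneousLax {R : Type*} [CommRing R] (A : Matrix (Fin n) (Fin n) R) (x ξ : Fin n → R) :
    Matrix (Fin n) (Fin n) R :=
  ((ξ ⬝ᵥ ξ) • 1 - vecMulVec ξ ξ) * (A - vecMulVec x x) * ((ξ ⬝ᵥ ξ) • 1 - vecMulVec ξ ξ)

theorem homogeneousLax_of_unit (A : Matrix (Fin n) (Fin n) ℝ) (x : Fin n → ℝ) {ξ : Fin n → ℝ}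
    (hξ : ξ ⬝ᵥ ξ = 1) : homogeneousLax A x ξ = moserLax A x ξ := by
  rw [homogeneousLax, moserLax, projPerp, hξ, one_smul]

theorem homogeneousLax_smul {R : Type*} [CommRing R] (A : Matrix (Fin n) (Fin n) R)
    (c : R) (x ξ : Fin n → R) : homogeneousLax A x (c • ξ) = c ^ 4 • homogeneousLax A x ξ := by
  have h : ((c • ξ) ⬝ᵥ (c • ξ)) • (1 : Matrix (Fin n) (Fin n) R) - vecMulVec (c • ξ) (c • ξ) =
      c ^ 2 • ((ξ ⬝ᵥ ξ) • 1 - vecMulVec ξ ξ) := by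
    simp only [dotProduct_smul, smul_dotProduct, smul_vecMulVec, vecMulVec_smul, smul_sub,
      smul_smul, smul_eq_mul]
    ring_nf
  rw [homogeneousLax, h, smul_mul_assoc, smul_mul_assoc, mul_smul_comm, smul_smul, homogeneousLax]
  ring_nf

theorem map_homogeneousLax {R S : Type*} [CommRing R] [CommRing S] (f : R →+* S)
    (A : Matrix (Fin n) (Fin n) R) (x ξ : Fin n → R) :
    (homogeneousLax A x ξ).map f = homogeneousLax (A.map f) (f ∘ x) (f ∘ ξ) := by
  have hv : ∀ u : Fin n → R, (vecMulVec u u).map f = vecMulVec (f ∘ u) (f ∘ u) := fun u => by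
    ext i j
    simp [vecMulVec_apply]
  have hd : ((ξ ⬝ᵥ ξ) • (1 : Matrix (Fin n) (Fin n) R)).map f = ((f ∘ ξ) ⬝ᵥ (f ∘ ξ)) • 1 := by
    ext i j
    simp [dotProduct, one_apply, apply_ite f]
  have hs : ∀ M N : Matrix (Fin n) (Fin n) R, (M - N).map f = M.map f - N.map f := fun M N =>
    Matrix.map_sub f (map_sub f) M N
  simp only [homogeneousLax, Matrix.map_mul, hs, hv, hd]

theorem isHermitian_vecMulVec_self (u : Fin n → ℝ) : (vecMulVec u u).IsHermitian := by
  ext i j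
  simp [vecMulVec_apply, mul_comm]

theorem isHermitian_projPerp (ξ : Fin n → ℝ) : (projPerp ξ).IsHermitian :=
  isHermitian_one.sub (isHermitian_vecMulVec_self ξ)

theorem isHermitian_moserLax {A : Matrix (Fin n) (Fin n) ℝ} (hA : A.IsHermitian)
    (x ξ : Fin n → ℝ) : (moserLax A x ξ).IsHermitian := by
  have h := isHermitian_mul_mul_conjTranspose (projPerp ξ)
    (hA.sub (isHermitian_vecMulVec_self x))
  rwa [(isHermitian_projPerp ξ).eq] at h

theorem projPerp_mulVec (ξ u : Fin n → ℝ) : projPerp ξ *ᵥ u = u - (ξ ⬝ᵥ u) • ξ := by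
  rw [projPerp, sub_mulVec, one_mulVec, vecMulVec_mulVec, op_smul_eq_smul]

theorem sub_vecMulVec_mulVec (A : Matrix (Fin n) (Fin n) ℝ) (x u : Fin n → ℝ) :
    (A - vecMulVec x x) *ᵥ u = A *ᵥ u - (x ⬝ᵥ u) • x := by
  rw [sub_mulVec, vecMulVec_mulVec, op_smul_eq_smul]

/-- The vectors isotropic for `A - x xᵀ` are the multiples of `A⁻¹ x`, when `x` is on the
ellipsoid. -/
theorem eq_smul_of_isotropic {A : Matrix (Fin n) (Fin n) ℝ} (hA : A.PosDef) {x ν w : Fin n → ℝ}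
    (hν : A *ᵥ ν = x) (hνx : ν ⬝ᵥ x = 1) (hw : w ⬝ᵥ ((A - vecMulVec x x) *ᵥ w) = 0) :
    w = (x ⬝ᵥ w) • ν := by
  by_contra hne
  have hpos := hA.dotProduct_mulVec_pos (sub_ne_zero.2 hne)
  have h1 : ν ⬝ᵥ (A *ᵥ w) = x ⬝ᵥ w := by rw [hA.1.dotProduct_mulVec_comm, hν]
  rw [sub_vecMulVec_mulVec, dotProduct_sub, dotProduct_smul, smul_eq_mul] at hw
  simp only [star_trivial, mulVec_sub, mulVec_smul, hν, dotProduct_sub, sub_dotProduct,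
    dotProduct_smul, smul_dotProduct, smul_eq_mul, h1, hνx] at hpos
  rw [dotProduct_comm w x] at hw hpos
  linarith

theorem sub_vecMulVec_mulVec_eq_zero {A : Matrix (Fin n) (Fin n) ℝ} {x ν : Fin n → ℝ}
    (hν : A *ᵥ ν = x) (hνx : ν ⬝ᵥ x = 1) : (A - vecMulVec x x) *ᵥ ν = 0 := by
  rw [sub_vecMulVec_mulVec, hν, dotProduct_comm, hνx, one_smul, sub_self]

theorem moserLax_mulVec (A : Matrix (Fin n) (Fin n) ℝ) (x ξ u : Fin n → ℝ) :
    moserLax A x ξ *ᵥ u = projPerp ξ *ᵥ ((A - vecMulVec x x) *ᵥ (projPerp ξ *ᵥ u)) := by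
  rw [moserLax, mulVec_mulVec, mulVec_mulVec, Matrix.mul_assoc]

theorem moserLax_mulVec_self (A : Matrix (Fin n) (Fin n) ℝ) (x : Fin n → ℝ) {ξ : Fin n → ℝ}
    (hξ : ξ ⬝ᵥ ξ = 1) : moserLax A x ξ *ᵥ ξ = 0 := by
  have h : projPerp ξ *ᵥ ξ = 0 := by rw [projPerp_mulVec, hξ, one_smul, sub_self]
  rw [moserLax_mulVec, h, mulVec_zero, mulVec_zero]

theorem moserLax_mulVec_eq_zero_iff {A : Matrix (Fin n) (Fin n) ℝ} (hA : A.PosDef)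
    {x ν ξ u : Fin n → ℝ} (hν : A *ᵥ ν = x) (hνx : ν ⬝ᵥ x = 1) (hνξ : ν ⬝ᵥ ξ = 0)
    (hξ : ξ ⬝ᵥ ξ = 1) :
    moserLax A x ξ *ᵥ u = 0 ↔ u ∈ Submodule.span ℝ (Set.range ![ξ, ν]) := by
  rw [range_cons_cons_empty, Submodule.mem_span_pair]
  constructor
  · intro hu
    set w := projPerp ξ *ᵥ u with hw
    have hiso : w ⬝ᵥ ((A - vecMulVec x x) *ᵥ w) = 0 := by
      have h := congrArg (u ⬝ᵥ ·) hu
      simp only [moserLax_mulVec, dotProduct_zero] at h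
      rwa [(isHermitian_projPerp ξ).dotProduct_mulVec_comm] at h
    have hwν := eq_smul_of_isotropic hA hν hνx hiso
    refine ⟨ξ ⬝ᵥ u, x ⬝ᵥ w, ?_⟩
    rw [← hwν, hw, projPerp_mulVec]
    abel
  · rintro ⟨a, b, rfl⟩
    have h : projPerp ξ *ᵥ ν = ν := by
      rw [projPerp_mulVec, dotProduct_comm, hνξ, zero_smul, sub_zero]
    have hLν : moserLax A x ξ *ᵥ ν = 0 := by
      rw [moserLax_mulVec, h, sub_vecMulVec_mulVec_eq_zero hν hνx, mulVec_zero]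
    rw [mulVec_add, mulVec_smul, mulVec_smul, moserLax_mulVec_self A x hξ, hLν, smul_zero,
      smul_zero, add_zero]

theorem rank_moserLax {A : Matrix (Fin n) (Fin n) ℝ} (hA : A.PosDef)
    {x ν ξ : Fin n → ℝ} (hν : A *ᵥ ν = x) (hνx : ν ⬝ᵥ x = 1) (hνξ : ν ⬝ᵥ ξ = 0)
    (hξ : ξ ⬝ᵥ ξ = 1) : (moserLax A x ξ).rank + 2 = n := by
  have hker : LinearMap.ker (moserLax A x ξ).mulVecLin =
      Submodule.span ℝ (Set.range ![ξ, ν]) := by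
    ext u
    rw [LinearMap.mem_ker, mulVecLin_apply, moserLax_mulVec_eq_zero_iff hA hν hνx hνξ hξ]
  have hli : LinearIndependent ℝ ![ξ, ν] := by
    refine LinearIndependent.pair_iff.2 fun a b hab => ?_
    have h1 := congrArg (· ⬝ᵥ ξ) hab
    simp only [add_dotProduct, smul_dotProduct, hξ, hνξ, smul_eq_mul, zero_dotProduct] at h1
    have ha : a = 0 := by linarith
    have h2 := congrArg (· ⬝ᵥ x) hab
    simp only [add_dotProduct, smul_dotProduct, ha, hνx, smul_eq_mul, zero_dotProduct] at h2
    exact ⟨ha, by linarith⟩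
  have h := LinearMap.finrank_range_add_finrank_ker (moserLax A x ξ).mulVecLin
  rw [hker, finrank_span_eq_card hli] at h
  simpa [Matrix.rank] using h

/-- The number of distinct eigenvalues of `L(x, ξ)` is one plus the number of distinct nonzero
ones, of which there are at most `n - 2`. -/
theorem card_eigenvalues_moserLax {A : Matrix (Fin n) (Fin n) ℝ} (hA : A.PosDef)
    {x ν ξ : Fin n → ℝ} (hν : A *ᵥ ν = x) (hνx : ν ⬝ᵥ x = 1) (hνξ : ν ⬝ᵥ ξ = 0)
    (hξ : ξ ⬝ᵥ ξ = 1) (hL : (moserLax A x ξ).IsHermitian) :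
    (Finset.univ.image hL.eigenvalues).card =
        ((Finset.univ.filter (hL.eigenvalues · ≠ 0)).image hL.eigenvalues).card + 1 ∧
      (Finset.univ.filter (hL.eigenvalues · ≠ 0)).card + 2 = n := by
  have hrank := rank_moserLax hA hν hνx hνξ hξ
  rw [hL.rank_eq_card_non_zero_eigs, Fintype.card_subtype] at hrank
  refine ⟨?_, hrank⟩
  have hξ0 : ξ ≠ 0 := fun h => by simp [h] at hξ
  obtain ⟨i₀, hi₀⟩ := hL.exists_eigenvalues_eq (a := 0)
    (by rw [moserLax_mulVec_self A x hξ, zero_smul]) hξ0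
  rw [← Finset.card_insert_of_notMem (a := (0 : ℝ)) (by simp)]
  congr 1
  ext a
  simp only [Finset.mem_image, Finset.mem_univ, true_and, Finset.mem_insert, Finset.mem_filter]
  constructor
  · rintro ⟨i, rfl⟩
    by_cases h : hL.eigenvalues i = 0
    · exact Or.inl h
    · exact Or.inr ⟨i, h, rfl⟩
  · rintro (rfl | ⟨i, -, rfl⟩)
    exacts [⟨i₀, hi₀⟩, ⟨i, rfl⟩]

/-- If `A` has simple spectrum, then the eigenspaces of `A - x xᵀ` meet the orthogonal complement
of a vector `ξ` that is not orthogonal to them in dimension at most one. -/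
theorem not_orthonormal_eigenvectors {A : Matrix (Fin n) (Fin n) ℝ} (hA : A.IsHermitian)
    (hdist : Function.Injective hA.eigenvalues) {x ξ v w w' : Fin n → ℝ} {μ : ℝ}
    (hv : (A - vecMulVec x x) *ᵥ v = μ • v) (hw : (A - vecMulVec x x) *ᵥ w = μ • w)
    (hw' : (A - vecMulVec x x) *ᵥ w' = μ • w') (hvξ : v ⬝ᵥ ξ ≠ 0) (hwξ : w ⬝ᵥ ξ = 0)
    (hwξ' : w' ⬝ᵥ ξ = 0) (hww : w ⬝ᵥ w = 1) (hww' : w' ⬝ᵥ w' = 1) (horth : w ⬝ᵥ w' = 0) :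
    False := by
  have hAeig : ∀ p : Fin n → ℝ, (A - vecMulVec x x) *ᵥ p = μ • p → x ⬝ᵥ p = 0 →
      A *ᵥ p = μ • p := fun p hp hxp => by
    rw [sub_vecMulVec_mulVec, hxp, zero_smul, sub_zero] at hp
    exact hp
  have hcomb : ∀ (a b : ℝ) (p q : Fin n → ℝ), (A - vecMulVec x x) *ᵥ p = μ • p →
      (A - vecMulVec x x) *ᵥ q = μ • q →
      (A - vecMulVec x x) *ᵥ (a • p - b • q) = μ • (a • p - b • q) := fun a b p q hp hq => by
    rw [mulVec_sub, mulVec_smul, mulVec_smul, hp, hq, smul_sub, smul_comm a, smul_comm b]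
  have main : ∀ p p' : Fin n → ℝ, (A - vecMulVec x x) *ᵥ p = μ • p →
      (A - vecMulVec x x) *ᵥ p' = μ • p' → p ⬝ᵥ ξ = 0 → p' ⬝ᵥ ξ = 0 →
      p' ⬝ᵥ p' = 1 → p ⬝ᵥ p' = 0 → x ⬝ᵥ p ≠ 0 → False := by
    intro p p' hp hp' hpξ hpξ' hpp' hpo hxp
    have h1 := hAeig _ (hcomb (x ⬝ᵥ p') (x ⬝ᵥ p) p p' hp hp') (by
      simp only [dotProduct_sub, dotProduct_smul, smul_eq_mul]; ring)
    have h2 := hAeig _ (hcomb (x ⬝ᵥ p) (x ⬝ᵥ v) v p hv hp) (by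
      simp only [dotProduct_sub, dotProduct_smul, smul_eq_mul]; ring)
    have h2ξ : ((x ⬝ᵥ p) • v - (x ⬝ᵥ v) • p) ⬝ᵥ ξ ≠ 0 := by
      simpa [sub_dotProduct, hpξ] using ⟨hxp, hvξ⟩
    obtain ⟨r, hr⟩ := hA.exists_eq_smul hdist h1 h2 (fun h => h2ξ (by rw [h, zero_dotProduct]))
    have hrξ := congrArg (· ⬝ᵥ ξ) hr
    simp only [sub_dotProduct, smul_dotProduct, hpξ, hpξ', smul_eq_mul] at hrξ h2ξ
    have hr0 : r = 0 := by
      refine (mul_eq_zero.1 ?_).resolve_right h2ξ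
      linarith
    have := congrArg (· ⬝ᵥ p') hr
    simp only [sub_dotProduct, smul_dotProduct, hr0, hpo, hpp', smul_eq_mul] at this
    exact hxp (by linarith)
  by_cases hxw : x ⬝ᵥ w = 0
  · by_cases hxw' : x ⬝ᵥ w' = 0
    · have hne : w' ≠ 0 := fun h => by simp [h] at hww'
      obtain ⟨r, hr⟩ := hA.exists_eq_smul hdist (hAeig w hw hxw) (hAeig w' hw' hxw') hne
      have hr0 : r = 0 := by
        rw [hr, smul_dotProduct, hww', smul_eq_mul, mul_one] at horth
        exact horth
      simp [hr, hr0] at hww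
    · exact main w' w hw' hw hwξ' hwξ hww (by rw [dotProduct_comm, horth]) hxw'
  · exact main w w' hw hw' hwξ hwξ' hww' horth hxw

/-- A nonzero-eigenvalue eigenvector of `L(x, ξ)` is orthogonal to `ξ`, and is an eigenvector of
`A - x xᵀ` modulo `ξ`. -/
theorem eigenvector_moserLax {A : Matrix (Fin n) (Fin n) ℝ} (hA : A.IsHermitian)
    {x ξ w : Fin n → ℝ} {μ : ℝ} (hξ : ξ ⬝ᵥ ξ = 1) (hμ : μ ≠ 0)
    (hw : moserLax A x ξ *ᵥ w = μ • w) :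
    w ⬝ᵥ ξ = 0 ∧ ∃ c : ℝ, (A - vecMulVec x x) *ᵥ w = μ • w + c • ξ := by
  have hwξ : w ⬝ᵥ ξ = 0 := (isHermitian_moserLax hA x ξ).dotProduct_eq_zero hw
    (by rw [moserLax_mulVec_self A x hξ, zero_smul]) hμ
  refine ⟨hwξ, ξ ⬝ᵥ ((A - vecMulVec x x) *ᵥ w), ?_⟩
  have h : projPerp ξ *ᵥ w = w := by
    rw [projPerp_mulVec, dotProduct_comm, hwξ, zero_smul, sub_zero]
  rw [moserLax_mulVec, h, projPerp_mulVec] at hw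
  rw [← hw, sub_add_cancel]

/-- If `ξ` is not orthogonal to any eigenspace of `A - x xᵀ` for a nonzero eigenvalue, then the
nonzero eigenvalues of `L(x, ξ)` are simple. -/
theorem injOn_eigenvalues_moserLax {A : Matrix (Fin n) (Fin n) ℝ} (hA : A.IsHermitian)
    (hdist : Function.Injective hA.eigenvalues) {x ξ : Fin n → ℝ} (hξ : ξ ⬝ᵥ ξ = 1)
    (hgen : ∀ μ : ℝ, μ ≠ 0 → ∀ u : Fin n → ℝ, u ≠ 0 → (A - vecMulVec x x) *ᵥ u = μ • u →
      ∃ v : Fin n → ℝ, (A - vecMulVec x x) *ᵥ v = μ • v ∧ v ⬝ᵥ ξ ≠ 0)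
    (hL : (moserLax A x ξ).IsHermitian) :
    Set.InjOn hL.eigenvalues {i | hL.eigenvalues i ≠ 0} := by
  intro i hi j _ hij
  by_contra hne
  obtain ⟨b, hort, hb, -⟩ := hL.exists_orthonormal_eigenvectors
  have hi' := hb i
  have hj' := hb j
  rw [← hij] at hj'
  set μ := hL.eigenvalues i
  obtain ⟨hiξ, c, hc⟩ := eigenvector_moserLax hA hξ hi hi'
  obtain ⟨hjξ, d, hd⟩ := eigenvector_moserLax hA hξ hi hj'
  have hii : b i ⬝ᵥ b i = 1 := by simp [hort]
  have hjj : b j ⬝ᵥ b j = 1 := by simp [hort]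
  have hijo : b i ⬝ᵥ b j = 0 := by simp [hort, hne]
  have hex : ∃ u : Fin n → ℝ, u ≠ 0 ∧ (A - vecMulVec x x) *ᵥ u = μ • u := by
    by_cases hc0 : c = 0
    · refine ⟨b i, fun h => by simp [h] at hii, by rw [hc, hc0, zero_smul, add_zero]⟩
    · refine ⟨d • b i - c • b j, fun h => hc0 ?_, ?_⟩
      · have := congrArg (· ⬝ᵥ b j) h
        simpa [sub_dotProduct, hijo, hjj] using this
      · rw [mulVec_sub, mulVec_smul, mulVec_smul, hc, hd]
        module
  obtain ⟨u, hu0, hu⟩ := hex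
  obtain ⟨v, hv, hvξ⟩ := hgen μ hi u hu0 hu
  have hcoef : ∀ (w : Fin n → ℝ) (e : ℝ), (A - vecMulVec x x) *ᵥ w = μ • w + e • ξ →
      (A - vecMulVec x x) *ᵥ w = μ • w := fun w e he => by
    have h := (hA.sub (isHermitian_vecMulVec_self x)).dotProduct_mulVec_comm v w
    rw [hv, he, dotProduct_add, dotProduct_smul, dotProduct_smul, smul_dotProduct,
      smul_eq_mul, smul_eq_mul, add_eq_left] at h
    rw [he, (mul_eq_zero.1 h).resolve_right hvξ, zero_smul, add_zero]
  exact not_orthonormal_eigenvectors hA hdist hv (hcoef _ _ hc) (hcoef _ _ hd) hvξ hiξ hjξ hii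
    hjj hijo

/-- Over each point of the ellipsoid there is a unit covector that is not orthogonal to any
eigenspace of `A - x xᵀ` for a nonzero eigenvalue. -/
theorem exists_generic_covector (hn : 3 ≤ n) {A : Matrix (Fin n) (Fin n) ℝ} (hA : A.PosDef)
    {x ν : Fin n → ℝ} (hν : A *ᵥ ν = x) (hνx : ν ⬝ᵥ x = 1) :
    ∃ ξ : Fin n → ℝ, ν ⬝ᵥ ξ = 0 ∧ ξ ⬝ᵥ ξ = 1 ∧
      ∀ μ : ℝ, μ ≠ 0 → ∀ u : Fin n → ℝ, u ≠ 0 → (A - vecMulVec x x) *ᵥ u = μ • u →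
        ∃ v : Fin n → ℝ, (A - vecMulVec x x) *ᵥ v = μ • v ∧ v ⬝ᵥ ξ ≠ 0 := by
  have hB : (A - vecMulVec x x).IsHermitian := hA.1.sub (isHermitian_vecMulVec_self x)
  obtain ⟨b, hort, hb, -⟩ := hB.exists_orthonormal_eigenvectors
  set η : Fin n → ℝ := ∑ i with hB.eigenvalues i ≠ 0, b i with hη
  have hbη : ∀ i, hB.eigenvalues i ≠ 0 → b i ⬝ᵥ η = 1 := fun i hi => by
    simp [hη, dotProduct_sum, hort, hi]
  have hνη : ν ⬝ᵥ η = 0 := by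
    rw [hη, dotProduct_sum]
    refine Finset.sum_eq_zero fun i hi => ?_
    refine hB.dotProduct_eq_zero (a := 0) ?_ (hb i) (Ne.symm (Finset.mem_filter.1 hi).2)
    rw [sub_vecMulVec_mulVec_eq_zero hν hνx, zero_smul]
  have hη0 : η ≠ 0 := by
    intro h0
    have hzero : ∀ i, b i = (x ⬝ᵥ b i) • ν := fun i => by
      have hi : hB.eigenvalues i = 0 := by
        by_contra hi
        have := hbη i hi
        simp [h0] at this
      refine eq_smul_of_isotropic hA hν hνx ?_
      rw [hb, hi, zero_smul, dotProduct_zero]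
    let i : Fin n := ⟨0, by omega⟩
    let j : Fin n := ⟨1, by omega⟩
    have hij : i ≠ j := by simp [i, j]
    have h1 : b i ⬝ᵥ b i = 1 := by simp [hort]
    have h2 : b j ⬝ᵥ b j = 1 := by simp [hort]
    have h3 : b i ⬝ᵥ b j = 0 := by simp [hort, hij]
    rw [hzero i, smul_dotProduct, dotProduct_smul, smul_eq_mul, smul_eq_mul] at h1
    rw [hzero j, smul_dotProduct, dotProduct_smul, smul_eq_mul, smul_eq_mul] at h2
    rw [hzero i, hzero j, smul_dotProduct, dotProduct_smul, smul_eq_mul, smul_eq_mul] at h3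
    rcases mul_eq_zero.1 h3 with h | h
    · rw [h, zero_mul] at h1
      exact zero_ne_one h1
    · rw [h] at h2
      simp at h2
  have hpos : 0 < η ⬝ᵥ η := by
    simpa using dotProduct_star_self_pos_iff.2 hη0
  have hs : Real.sqrt (η ⬝ᵥ η) ≠ 0 := (Real.sqrt_pos.2 hpos).ne'
  refine ⟨(Real.sqrt (η ⬝ᵥ η))⁻¹ • η, by rw [dotProduct_smul, hνη, smul_zero], ?_, ?_⟩
  · rw [dotProduct_smul, smul_dotProduct, smul_eq_mul, smul_eq_mul]
    field_simp
    rw [Real.sq_sqrt hpos.le]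
  · intro μ hμ u hu0 hu
    obtain ⟨i, rfl⟩ := hB.exists_eigenvalues_eq hu hu0
    refine ⟨b i, hb i, ?_⟩
    rw [dotProduct_smul, hbη i hμ, smul_eq_mul, mul_one]
    exact inv_ne_zero hs

end MoserLax

/-- Starting from any unit covector `ξ₀` over `x`, moving towards a unit covector `ξ₁` with
nonvanishing Hankel determinant makes the determinant nonzero at all but finitely many times. -/
theorem eventually_hankelDet_homogeneousLax_ne_zero {n : ℕ} (m : ℕ)
    (A : Matrix (Fin n) (Fin n) ℝ) (x ξ₀ ξ₁ : Fin n → ℝ)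
    (h : hankelDet m (homogeneousLax A x ξ₁) ≠ 0) :
    ∀ᶠ t in nhdsWithin (0 : ℝ) {0}ᶜ,
      hankelDet m (homogeneousLax A x (ξ₀ + t • (ξ₁ - ξ₀))) ≠ 0 := by
  let q : Polynomial ℝ := hankelDet m (homogeneousLax (A.map Polynomial.C) (Polynomial.C ∘ x)
    fun i => Polynomial.C (ξ₀ i) + Polynomial.X * Polynomial.C (ξ₁ i - ξ₀ i))
  have hq : ∀ t, q.eval t = hankelDet m (homogeneousLax A x (ξ₀ + t • (ξ₁ - ξ₀))) := fun t => by
    rw [← Polynomial.coe_evalRingHom, map_hankelDet, map_homogeneousLax]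
    congr 2 <;> ext <;> simp
  have hq0 : q ≠ 0 := fun h0 => h (by
    have := hq 1
    rwa [h0, Polynomial.eval_zero, one_smul, add_sub_cancel, eq_comm] at this)
  have hfin : (q.rootSet ℝ \ {0}).Finite := (q.rootSet_finite ℝ).subset Set.sdiff_subset
  have hmem : (q.rootSet ℝ \ {0})ᶜ ∈ nhds (0 : ℝ) :=
    hfin.isClosed.isOpen_compl.mem_nhds (by simp)
  filter_upwards [mem_nhdsWithin_of_mem_nhds hmem, self_mem_nhdsWithin] with t ht ht0 hzero
  refine ht ⟨?_, ht0⟩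
  rw [Polynomial.mem_rootSet]
  exact ⟨hq0, by simpa [hq t] using hzero⟩

/-- For `n ≥ 3` and `A` symmetric positive definite with `n` distinct eigenvalues,
there is an open dense subset of `S*E_A` on which the spectrum of `L(x, ξ)` consists
of exactly `n - 1` distinct real numbers, i.e. the `n - 2` nonzero eigenvalues are
pairwise distinct, in addition to the eigenvalue `0` of multiplicity two. -/
theorem stmt6 {n : ℕ} (hn : 3 ≤ n) (A : Matrix (Fin n) (Fin n) ℝ) (hA : A.PosDef)
    (hdist : Function.Injective hA.1.eigenvalues) :
    ∃ U : Set (CosphereBundle A),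
      IsOpen U ∧ Dense U ∧
      ∀ p ∈ U, (spectrum ℝ (moserLax A p.1.1 p.1.2)).ncard = n - 1 := by
  have hcont : Continuous fun p : CosphereBundle A => moserLax A p.1.1 p.1.2 := by
    have h1 : Continuous fun p : CosphereBundle A => p.1 := continuous_subtype_val
    unfold moserLax projPerp
    fun_prop
  have hν : ∀ x : Fin n → ℝ, A *ᵥ (A⁻¹ *ᵥ x) = x := fun x => by
    rw [mulVec_mulVec, mul_nonsing_inv A hA.det_pos.ne'.isUnit, one_mulVec]
  refine ⟨{p | hankelDet (n - 1) (moserLax A p.1.1 p.1.2) ≠ 0},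
    isOpen_ne_fun ((continuous_hankelDet _).comp hcont) continuous_const, ?_, ?_⟩
  · rintro ⟨⟨x, ξ₀⟩, hx, hξ₀, hnorm₀⟩
    obtain ⟨ξ₁, hξ₁, hnorm₁, hgen⟩ := exists_generic_covector hn hA (hν x) hx
    have hgood : hankelDet (n - 1) (homogeneousLax A x ξ₁) ≠ 0 := by
      have hL := isHermitian_moserLax hA.1 x ξ₁
      obtain ⟨hcard, hrank⟩ := card_eigenvalues_moserLax hA (hν x) hx hξ₁ hnorm₁ hL
      rw [homogeneousLax_of_unit A x hnorm₁, hankelDet_ne_zero_iff hL, hcard,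
        Finset.card_image_of_injOn]
      · omega
      · simpa using injOn_eigenvalues_moserLax hA.1 hdist hnorm₁ hgen hL
    let γ : ℝ → Fin n → ℝ := fun t => ξ₀ + t • (ξ₁ - ξ₀)
    have hγ : Continuous γ := by fun_prop
    have hγ0 : γ 0 = ξ₀ := by simp [γ]
    have hγν : ∀ t, A⁻¹ *ᵥ x ⬝ᵥ γ t = 0 := fun t => by
      simp only [γ, dotProduct_add, dotProduct_smul, dotProduct_sub, hξ₁, hξ₀]
      simp
    have hnormalize : ∀ t, 0 < γ t ⬝ᵥ γ t →
        ((√(γ t ⬝ᵥ γ t))⁻¹ • γ t) ⬝ᵥ ((√(γ t ⬝ᵥ γ t))⁻¹ • γ t) = 1 := fun t ht => by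
      have hs : √(γ t ⬝ᵥ γ t) ≠ 0 := (Real.sqrt_pos.2 ht).ne'
      rw [dotProduct_smul, smul_dotProduct, smul_eq_mul, smul_eq_mul]
      field_simp
      rw [Real.sq_sqrt ht.le]
    have hpos : ∀ᶠ t in nhds (0 : ℝ), 0 < γ t ⬝ᵥ γ t := by
      refine ContinuousAt.eventually_lt continuousAt_const ?_ ?_
      · fun_prop
      · rw [hγ0, hnorm₀]
        exact one_pos
    have hne := eventually_hankelDet_homogeneousLax_ne_zero (n - 1) A x ξ₀ ξ₁ hgood
    have htend : Filter.Tendsto (fun t => (x, (√(γ t ⬝ᵥ γ t))⁻¹ • γ t))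
        (nhdsWithin (0 : ℝ) {0}ᶜ) (nhds (x, ξ₀)) := by
      have hc : ContinuousAt (fun t => (x, (√(γ t ⬝ᵥ γ t))⁻¹ • γ t)) 0 := by
        have hs : √(γ 0 ⬝ᵥ γ 0) ≠ 0 := by rw [hγ0, hnorm₀, Real.sqrt_one]; exact one_ne_zero
        have hd : ContinuousAt (fun t => √(γ t ⬝ᵥ γ t)) 0 := by fun_prop
        exact continuousAt_const.prodMk ((hd.inv₀ hs).smul hγ.continuousAt)
      have h0 := hc.tendsto
      simp only [hγ0, hnorm₀, Real.sqrt_one, inv_one, one_smul] at h0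
      exact h0.mono_left nhdsWithin_le_nhds
    have hind : Topology.IsInducing fun p : CosphereBundle A => p.1 := ⟨rfl⟩
    rw [hind.closure_eq_preimage_closure_image]
    refine mem_closure_of_tendsto htend ?_
    filter_upwards [hne, mem_nhdsWithin_of_mem_nhds hpos] with t ht htpos
    have hunit := hnormalize t htpos
    refine ⟨⟨(x, (√(γ t ⬝ᵥ γ t))⁻¹ • γ t), hx, ?_, hunit⟩, ?_, rfl⟩
    · simp only [dotProduct_smul, hγν, smul_zero]
    · have hs : √(γ t ⬝ᵥ γ t) ≠ 0 := (Real.sqrt_pos.2 htpos).ne'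
      change hankelDet (n - 1) (moserLax A x _) ≠ 0
      rw [← homogeneousLax_of_unit A x hunit, homogeneousLax_smul, hankelDet_smul]
      refine mul_ne_zero (pow_ne_zero _ (Finset.prod_ne_zero_iff.2 fun i _ => ?_)) ht
      exact pow_ne_zero _ (pow_ne_zero _ (inv_ne_zero hs))
  · rintro ⟨⟨x, ξ⟩, hx, hξ, hnorm⟩ hp
    have hL := isHermitian_moserLax hA.1 x ξ
    obtain ⟨hcard, hrank⟩ := card_eigenvalues_moserLax hA (hν x) hx hξ hnorm hL
    have hlow := (hankelDet_ne_zero_iff hL _).1 hp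
    have hle : ((Finset.univ.filter (hL.eigenvalues · ≠ 0)).image hL.eigenvalues).card ≤
        (Finset.univ.filter (hL.eigenvalues · ≠ 0)).card := Finset.card_image_le
    change (spectrum ℝ (moserLax A x ξ)).ncard = n - 1
    rw [hL.spectrum_real_eq_range_eigenvalues, ← Set.image_univ, ← Finset.coe_univ,
      ← Finset.coe_image, Set.ncard_coe_finset]
    omega
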